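/- arXiv:2601.13455 — 2 statements merged into one kernel-verified Lean document; each statement's English description precedes it below -/
import Mathlib

section
/- Let Γ = (V, E, s, t) be a finite connected quiver with no isolated vertices and nonempty boundary ∂Γ, and let G be a group. Suppose g : V → G satisfies g(v) = 1 for every boundary vertex v ∈ ∂Γ, and a : E → G is such that g(t(e)) · a(e) · g(s(e))⁻¹ = a(e) for every edge e ∈ E. Then g(v) = 1 for every vertex v ∈ V. Consequently, the action of the gauge group G^{Γ_int} (extended by the identity on ∂Γ) on (G × G)^E given by g · (a, b)_e = (g(t(e)) a_e g(s(e))⁻¹, g(s(e)) b_e g(s(e))⁻¹) is free; this is the freeness of the G^{Γ_int}-action on the moment-map level set μ⁻¹(1) asserted in the Lemma of Section 6.2. -/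
/-- Freeness of the gauge group action on the moment-map level set (Lemma, Section 6.2):
if `g : V → G` is trivial on the boundary of a finite connected quiver with no isolated
vertices and nonempty boundary, and fixes some `a : E → G` under the gauge action, then
`g` is trivial everywhere; consequently the `G^{Γ_int}` action on `(G × G)^E` at the
moment level set is free. -/
theorem quiver_gauge_action_free
    {V E : Type*} [Fintype V] [Fintype E] [DecidableEq V]
    (s t : E → V)
    (hNoIso : ∀ v : V, ∃ e : E, s e = v ∨ t e = v)
    (hConn : ∀ v w : V, Relation.EqvGen (fun x y => ∃ e : E, s e = x ∧ t e = y) v w)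
    (boundary : Set V)
    (hBdry : boundary = {v : V |
      (Finset.univ.filter fun e : E => s e = v).card +
      (Finset.univ.filter fun e : E => t e = v).card = 1})
    (hBdryNe : boundary.Nonempty)
    {G : Type*} [Group G]
    (g : V → G) (a : E → G)
    (hgBdry : ∀ v ∈ boundary, g v = 1)
    (hFix : ∀ e : E, g (t e) * a e * (g (s e))⁻¹ = a e) :
    (∀ v : V, g v = 1) ∧
    -- Consequently, the gauge action of `G^{Γ_int}` (extended by 1 on the boundary)
    -- on `(G × G)^E` is free:
    (∀ g' : V → G, (∀ v ∈ boundary, g' v = 1) →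
      ∀ a' b' : E → G,
        (∀ e : E, (g' (t e) * a' e * (g' (s e))⁻¹, g' (s e) * b' e * (g' (s e))⁻¹)
          = (a' e, b' e)) →
        ∀ v : V, g' v = 1) := by
  have key : ∀ (h : V → G), (∀ v ∈ boundary, h v = 1) → ∀ c : E → G,
      (∀ e : E, h (t e) * c e * (h (s e))⁻¹ = c e) → ∀ v : V, h v = 1 := by
    intro h hb c hc v
    obtain ⟨w, hw⟩ := hBdryNe
    have step : ∀ x y : V, Relation.EqvGen (fun x y => ∃ e : E, s e = x ∧ t e = y) x y →
        (h x = 1 ↔ h y = 1) := by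
      intro x y hxy
      induction hxy with
      | rel x y hr =>
        obtain ⟨e, rfl, rfl⟩ := hr
        have he := hc e
        constructor
        · intro h1
          simpa [h1] using he
        · intro h1
          simpa [h1] using he
      | refl x => exact Iff.rfl
      | symm x y _ ih => exact ih.symm
      | trans x y z _ _ ih1 ih2 => exact ih1.trans ih2
    exact (step w v (hConn w v)).1 (hb w hw)
  refine ⟨key g hgBdry a hFix, ?_⟩
  intro g' hg' a' b' hab
  exact key g' hg' a' (fun e => (Prod.mk.inj (hab e)).1)
end

section
/- Let G be a group, S a G-set, and Φ : S → G an equivariant map, i.e. Φ(g · s) = g Φ(s) g⁻¹ for all g ∈ G, s ∈ S. Set Z = {(s, a, b) ∈ S × G × G : Φ(s) · a b a⁻¹ = 1}, with the diagonal G-action h · (s, a, b) = (h · s, h a, b) and the residual G-action k ∗ (s, a, b) = (s, a k⁻¹, k b k⁻¹). Then: (i) Z is invariant under both actions and the two actions commute; (ii) the diagonal action on Z is free; (iii) the map S → Z/G sending s to the diagonal-orbit of (s, 1, Φ(s)⁻¹) is a bijection, equivariant from the given G-action on S to the action on Z/G induced by ∗. (This is the set-theoretic form of the identity (M ⊛ D(G))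 // G ≅ M, the key ingredient in the proofs of the homotopy-invariance Theorem 6.3 for the spaces 𝒩_G(Γ) and of Proposition 7.1.) -/
/-- The diagonal `G`-action on `S × D(G)`, fusing the action on `S` with the left factor
of the double: `h · (s, a, b) = (h • s, h a, b)`. -/
def diagAct {G S : Type*} [Group G] [MulAction G S] (h : G) (p : S × G × G) : S × G × G :=
  (h • p.1, h * p.2.1, p.2.2)

/-- The residual `G`-action `k ∗ (s, a, b) = (s, a k⁻¹, k b k⁻¹)`. -/
def resAct {G S : Type*} [Group G] (k : G) (p : S × G × G) : S × G × G :=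
  (p.1, p.2.1 * k⁻¹, k * p.2.2 * k⁻¹)

/-- The unit level set `Z = {(s, a, b) : Φ(s) · a b a⁻¹ = 1}` of the fused moment map. -/
def fusedLevel {G S : Type*} [Group G] (Φ : S → G) : Set (S × G × G) :=
  {p : S × G × G | Φ p.1 * (p.2.1 * p.2.2 * p.2.1⁻¹) = 1}

/-- The orbit relation of the diagonal action on the level set `Z`. -/
def diagOrbitRel {G S : Type*} [Group G] [MulAction G S] (Φ : S → G)
    (p q : fusedLevel Φ) : Prop :=
  ∃ h : G, diagAct h (p : S × G × G) = (q : S × G × G)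

/-- The base point `(s, 1, Φ(s)⁻¹) ∈ Z`. -/
def basePoint {G S : Type*} [Group G] (Φ : S → G) (s : S) : fusedLevel Φ :=
  ⟨(s, 1, (Φ s)⁻¹), by simp [fusedLevel]⟩

/-- The residual action preserves the level set `Z`. -/
def resActZ {G S : Type*} [Group G] (Φ : S → G) (k : G) (p : fusedLevel Φ) : fusedLevel Φ :=
  ⟨resAct k (p : S × G × G), by
    obtain ⟨⟨s, a, b⟩, hp⟩ := p
    simp only [fusedLevel, Set.mem_setOf_eq, resAct] at hp ⊢
    calc Φ s * (a * k⁻¹ * (k * b * k⁻¹) * (a * k⁻¹)⁻¹)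
        = Φ s * (a * b * a⁻¹) := by group
      _ = 1 := hp⟩

/-- Set-theoretic form of the identity `(M ⊛ D(G)) ∕∕ G ≅ M` (key ingredient in the proofs
of Theorem 6.3 and Proposition 7.1): for an equivariant map `Φ : S → G`, (i) the level set
`Z` is invariant under the diagonal and residual actions, which commute; (ii) the diagonal
action on `Z` is free; (iii) `s ↦ [(s, 1, Φ(s)⁻¹)]` is a bijection from `S` onto `Z/G`,
equivariant for the action induced by the residual action (which is well defined on `Z/G`). -/
theorem fusion_double_reduction {G S : Type*} [Group G] [MulAction G S] (Φ : S → G)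
    (hΦ : ∀ (g : G) (s : S), Φ (g • s) = g * Φ s * g⁻¹) :
    -- (i) invariance and commutation
    ((∀ h : G, ∀ p ∈ fusedLevel Φ, diagAct h p ∈ fusedLevel Φ) ∧
     (∀ k : G, ∀ p ∈ fusedLevel Φ, resAct k p ∈ fusedLevel Φ) ∧
     (∀ h k : G, ∀ p : S × G × G, diagAct h (resAct k p) = resAct k (diagAct h p))) ∧
    -- (ii) freeness of the diagonal action on Z
    (∀ h : G, ∀ p : fusedLevel Φ,
      diagAct h (p : S × G × G) = (p : S × G × G) → h = 1) ∧
    -- (iii) the residual action descends to Z/G, and s ↦ [(s, 1, Φ(s)⁻¹)] is an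
    -- equivariant bijection S → Z/G
    ((∀ (k : G) (p q : fusedLevel Φ), diagOrbitRel Φ p q →
        Quot.mk (diagOrbitRel Φ) (resActZ Φ k p) = Quot.mk (diagOrbitRel Φ) (resActZ Φ k q)) ∧
     Function.Bijective (fun s : S => Quot.mk (diagOrbitRel Φ) (basePoint Φ s)) ∧
     (∀ (g : G) (s : S),
        Quot.mk (diagOrbitRel Φ) (basePoint Φ (g • s)) =
          Quot.mk (diagOrbitRel Φ) (resActZ Φ g (basePoint Φ s)))) := by
  refine ⟨⟨?_, ?_, ?_⟩, ?_, ?_, ⟨?_, ?_⟩, ?_⟩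
  · rintro h ⟨s, a, b⟩ hp
    simp only [fusedLevel, Set.mem_setOf_eq, diagAct] at hp ⊢
    rw [hΦ]
    calc h * Φ s * h⁻¹ * (h * a * b * (h * a)⁻¹)
        = h * (Φ s * (a * b * a⁻¹)) * h⁻¹ := by group
      _ = 1 := by rw [hp]; group
  · intro k p hp
    exact (resActZ Φ k ⟨p, hp⟩).2
  · rintro h k ⟨s, a, b⟩
    simp [diagAct, resAct, mul_assoc]
  · rintro h ⟨⟨s, a, b⟩, hp⟩ he
    simp only [diagAct, Prod.mk.injEq] at he
    simpa using he.2.1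
  · rintro k p q ⟨h, hh⟩
    apply Quot.sound
    refine ⟨h, ?_⟩
    change diagAct h (resAct k p.1) = resAct k q.1
    rw [← hh]
    simp [diagAct, resAct, mul_assoc]
  · intro s t hst
    have key : ∀ p q : fusedLevel Φ, diagOrbitRel Φ p q →
        p.1.2.1⁻¹ • p.1.1 = q.1.2.1⁻¹ • q.1.1 := by
      rintro p q ⟨h, hh⟩
      rw [← hh]
      simp [diagAct, mul_smul]
    have := congrArg (Quot.lift (fun p : fusedLevel Φ => p.1.2.1⁻¹ • p.1.1) key) hst
    simpa [basePoint] using this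
  · intro z
    induction z using Quot.ind with
    | mk p =>
      obtain ⟨⟨s, a, b⟩, hp⟩ := p
      refine ⟨a⁻¹ • s, Quot.sound ⟨a, ?_⟩⟩
      simp only [fusedLevel, Set.mem_setOf_eq] at hp
      have hb : (Φ s)⁻¹ = a * b * a⁻¹ := inv_eq_of_mul_eq_one_right hp
      have hb2 : (a⁻¹ * Φ s * a⁻¹⁻¹)⁻¹ = b := by
        calc (a⁻¹ * Φ s * a⁻¹⁻¹)⁻¹ = a⁻¹ * (Φ s)⁻¹ * a := by group
          _ = b := by rw [hb]; group
      simp only [diagAct, basePoint, hΦ, hb2, smul_inv_smul, mul_one]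
  · intro g s
    apply Quot.sound
    refine ⟨g⁻¹, ?_⟩
    simp [diagAct, basePoint, resActZ, resAct, hΦ, mul_assoc]
end
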